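/- Let j and k be integers with 1 ≤ j ≤ k. If the interior of the dilate j•P contains a lattice point, then the interior of k•P contains a lattice point. -/

import Mathlib

open Set

/-- A lattice point of `ℝⁿ`: all coordinates are integers. -/
def IsLatticePt {n : ℕ} (x : Fin n → ℝ) : Prop := ∀ i, ∃ m : ℤ, x i = (m : ℝ)

/-- The tangent cone of `P` at a face `F`: the set of all finite nonnegative real linear
combinations of vectors `p - f` with `p ∈ P` and `f ∈ F`. -/
def tangentCone {n : ℕ} (P F : Set (Fin n → ℝ)) : Set (Fin n → ℝ) :=
  { x | ∃ (k : ℕ) (c : Fin k → ℝ) (p f : Fin k → (Fin n → ℝ)),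
      (∀ i, 0 ≤ c i) ∧ (∀ i, p i ∈ P) ∧ (∀ i, f i ∈ F) ∧
      x = ∑ i, c i • (p i - f i) }

/-- The monoid of lattice points of the tangent cone. -/
def latticeTangentCone {n : ℕ} (P F : Set (Fin n → ℝ)) : Set (Fin n → ℝ) :=
  { x ∈ tangentCone P F | IsLatticePt x }

/-- The dilate `k • P` of a subset `P ⊆ ℝⁿ` by an integer `k`. -/
def dilate {n : ℕ} (k : ℤ) (P : Set (Fin n → ℝ)) : Set (Fin n → ℝ) :=
  (fun p => k • p) '' P

/-- If `1 ≤ j ≤ k` and the interior of `j • P` contains a lattice point,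
then so does the interior of `k • P`. -/
theorem stmt3 {n : ℕ} (hn : 1 ≤ n) (P : Set (Fin n → ℝ))
    (V : Finset (Fin n → ℝ)) (hV : ∀ v ∈ V, IsLatticePt v)
    (hP : P = convexHull ℝ (V : Set (Fin n → ℝ)))
    (hdim : affineSpan ℝ P = ⊤)
    (j k : ℤ) (hj : 1 ≤ j) (hjk : j ≤ k)
    (h : ∃ x ∈ interior (dilate j P), IsLatticePt x) :
    ∃ x ∈ interior (dilate k P), IsLatticePt x := by
  obtain ⟨x, hx, hxl⟩ := h
  have hconv : Convex ℝ P := hP ▸ convex_convexHull ℝ _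
  have hVne : V.Nonempty := by
    obtain ⟨p, hp, -⟩ := interior_subset hx
    rw [hP] at hp
    have := convexHull_nonempty_iff.1 ⟨p, hp⟩
    simpa using this
  obtain ⟨v, hv⟩ := hVne
  have hvP : v ∈ P := by
    rw [hP]
    exact subset_convexHull ℝ _ hv
  refine ⟨x + (k - j) • v, ?_, ?_⟩
  · rw [mem_interior]
    refine ⟨(fun y => y - (k - j) • v) ⁻¹' interior (dilate j P), ?_, ?_, ?_⟩
    · intro y hy
      obtain ⟨p, hp, hpy⟩ := interior_subset hy
      have hj' : (1 : ℝ) ≤ j := by exact_mod_cast hj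
      have hjk' : (j : ℝ) ≤ k := by exact_mod_cast hjk
      have hk : (0 : ℝ) < k := by linarith
      refine ⟨((j : ℝ) / k) • p + (((k : ℝ) - j) / k) • v, ?_, ?_⟩
      · refine hconv hp hvP (by positivity) (div_nonneg (by linarith) hk.le) ?_
        field_simp
        ring
      · have hy' : y = j • p + (k - j) • v := by
          have hpy' : j • p = y - (k - j) • v := hpy
          rw [hpy']
          abel
        rw [hy']
        ext i
        simp only [Pi.add_apply, Pi.smul_apply]
        simp only [zsmul_eq_mul, smul_eq_mul]
        push_cast
        field_simp
    · exact isOpen_interior.preimage (by fun_prop)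
    · simpa using hx
  · intro i
    obtain ⟨a, ha⟩ := hxl i
    obtain ⟨b, hb⟩ := hV v hv i
    refine ⟨a + (k - j) * b, ?_⟩
    simp only [Pi.add_apply, Pi.smul_apply]
    simp only [zsmul_eq_mul, ha, hb]
    push_cast
    ring
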